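/- Let Ω, Ω₁ ⊂ ℝ² be bounded open sets with smooth boundary and Φ ∈ O(Ω;Ω₁). Then Im ∫_Ω f_Φ · ∂²_z̄ψ dx dy = 0 for every smooth ψ : Ω̄ → ℝ vanishing on ∂Ω (i.e. Φ is quasi-rigid) if and only if the following all hold: Area(Ω) = Area(Ω₁); (i) Im(∂²_z̄ f_Φ) = 0 on Ω; and (ii) Im(f_Φ(z) τ(z)²) = 0 for every z ∈ ∂Ω, where τ(z) ∈ ℂ is a unit tangent vector to ∂Ω at z (condition (ii) is the statement Im(f_Φ dz/dz̄) = 0 on ∂Ω, i.e. the Hopf differential f_Φ dz² is real along ∂Ω). -/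

import Mathlib

open MeasureTheory

/-- Partial derivative in the `x`-direction, taken within a set `s`. -/
noncomputable def pdxW {E : Type*} [NormedAddCommGroup E] [NormedSpace ℝ E]
    (s : Set (ℝ × ℝ)) (f : ℝ × ℝ → E) (p : ℝ × ℝ) : E := fderivWithin ℝ f s p (1, 0)

/-- Partial derivative in the `y`-direction, taken within a set `s`. -/
noncomputable def pdyW {E : Type*} [NormedAddCommGroup E] [NormedSpace ℝ E]
    (s : Set (ℝ × ℝ)) (f : ℝ × ℝ → E) (p : ℝ × ℝ) : E := fderivWithin ℝ f s p (0, 1)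

/-- Euclidean dot product on `ℝ²`. -/
def dot (a b : ℝ × ℝ) : ℝ := a.1 * b.1 + a.2 * b.2

/-- The Hopf function `f_Φ := |Φ_y|² − |Φ_x|² + 2i (Φ_x·Φ_y)`, with the derivatives of
`Φ` taken within `closure Ω` (so that it is also defined on `∂Ω`). -/
noncomputable def hopfW (Ω : Set (ℝ × ℝ)) (Φ : ℝ × ℝ → ℝ × ℝ) (p : ℝ × ℝ) : ℂ :=
  ((dot (pdyW (closure Ω) Φ p) (pdyW (closure Ω) Φ p)
      - dot (pdxW (closure Ω) Φ p) (pdxW (closure Ω) Φ p) : ℝ) : ℂ)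
    + 2 * Complex.I * ((dot (pdxW (closure Ω) Φ p) (pdyW (closure Ω) Φ p) : ℝ) : ℂ)

/-- The Wirtinger derivative `∂_z̄ := ½(∂_x + i ∂_y)`, taken within `closure Ω`. -/
noncomputable def dzbarW (Ω : Set (ℝ × ℝ)) (f : ℝ × ℝ → ℂ) (p : ℝ × ℝ) : ℂ :=
  (1 / 2 : ℂ) * (pdxW (closure Ω) f p + Complex.I * pdyW (closure Ω) f p)

/-- `Ω` has smooth boundary: every boundary point admits a smooth local defining
function with nonvanishing differential. -/
def HasSmoothBoundary (Ω : Set (ℝ × ℝ)) : Prop :=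
  ∀ p ∈ frontier Ω, ∃ (U : Set (ℝ × ℝ)) (ρ : ℝ × ℝ → ℝ),
    IsOpen U ∧ p ∈ U ∧ ContDiff ℝ (⊤ : ℕ∞) ρ ∧ (∀ q ∈ U, fderiv ℝ ρ q ≠ 0) ∧
      Ω ∩ U = {q ∈ U | ρ q < 0}

/-- `τ ∈ ℂ` is a unit tangent vector to `∂Ω` at `z`: it has modulus one and is the
velocity at `z` of some curve running inside `∂Ω`. -/
def IsUnitTangent (Ω : Set (ℝ × ℝ)) (z : ℝ × ℝ) (τ : ℂ) : Prop :=
  ‖τ‖ = 1 ∧ ∃ γ : ℝ → ℝ × ℝ, (∀ s, γ s ∈ frontier Ω) ∧ γ 0 = z ∧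
    HasDerivAt γ (τ.re, τ.im) 0

/-- `Φ ∈ O(Ω; Ω₁)`: an area-preserving (Gram determinant `≡ 1`) diffeomorphism of
`Ω` onto `Ω₁`, smooth up to the boundary. -/
def IsAPD (Ω Ω₁ : Set (ℝ × ℝ)) (Φ : ℝ × ℝ → ℝ × ℝ) : Prop :=
  ContDiffOn ℝ (⊤ : ℕ∞) Φ (closure Ω) ∧ Set.InjOn Φ Ω ∧ Φ '' Ω = Ω₁ ∧
    ∀ p ∈ Ω, dot (pdxW (closure Ω) Φ p) (pdxW (closure Ω) Φ p)
        * dot (pdyW (closure Ω) Φ p) (pdyW (closure Ω) Φ p)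
      - dot (pdxW (closure Ω) Φ p) (pdyW (closure Ω) Φ p) ^ 2 = 1

section Helpers
open Filter Topology Set
open scoped ContDiff

namespace HopfAux

/-- local defining function -/
def DefFn (Ω U : Set (ℝ × ℝ)) (ρ : ℝ × ℝ → ℝ) : Prop :=
  IsOpen U ∧ ContDiff ℝ ∞ ρ ∧ (∀ q ∈ U, fderiv ℝ ρ q ≠ 0) ∧ Ω ∩ U = {q ∈ U | ρ q < 0}

/-- tangent vectors -/
def Tan (Ω : Set (ℝ × ℝ)) (z v : ℝ × ℝ) : Prop :=
  ∃ γ : ℝ → ℝ × ℝ, (∀ s, γ s ∈ frontier Ω) ∧ γ 0 = z ∧ HasDerivAt γ v 0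

variable {Ω U : Set (ℝ × ℝ)} {ρ : ℝ × ℝ → ℝ}

lemma DefFn.mem_iff (h : DefFn Ω U ρ) {q} (hq : q ∈ U) : q ∈ Ω ↔ ρ q < 0 := by
  have := Set.ext_iff.1 h.2.2.2 q
  simp only [mem_inter_iff, mem_setOf_eq, hq, and_true, true_and] at this
  exact this

lemma DefFn.diff (h : DefFn Ω U ρ) : Differentiable ℝ ρ := h.2.1.differentiable (by simp)

lemma DefFn.near (h : DefFn Ω U ρ) {q} (hq : q ∈ U) (h0 : ρ q = 0) {v : ℝ × ℝ}
    (hv : fderiv ℝ ρ q v < 0) : ∀ᶠ t in 𝓝[>] (0 : ℝ), q + t • v ∈ Ω := by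
  have hl : HasDerivAt (fun t : ℝ => q + t • v) v 0 := by
    simpa using ((hasDerivAt_id (0 : ℝ)).smul_const v).const_add q
  have h1 : HasDerivAt (fun t : ℝ => ρ (q + t • v)) (fderiv ℝ ρ q v) 0 := by
    have h2 : HasFDerivAt ρ (fderiv ℝ ρ q) (q + (0 : ℝ) • v) := by
      simpa using (h.diff q).hasFDerivAt
    exact h2.comp_hasDerivAt 0 hl
  have hU : ∀ᶠ t in 𝓝 (0 : ℝ), q + t • v ∈ U := by
    have := hl.continuousAt
    apply this
    simpa using h.1.mem_nhds hq
  have h3 := (hasDerivAt_iff_tendsto_slope_zero.1 h1).mono_left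
    (nhdsWithin_mono 0 (fun t (ht : 0 < t) => ne_of_gt ht))
  have h4 := h3.eventually (gt_mem_nhds hv)
  filter_upwards [h4, hU.filter_mono nhdsWithin_le_nhds, self_mem_nhdsWithin] with t ht htU ht0
  rw [h.mem_iff htU]
  simp only [zero_add, zero_smul, add_zero, h0, sub_zero, smul_eq_mul] at ht
  have ht0 : 0 < t := ht0
  by_contra hc
  push Not at hc
  have := mul_nonneg (inv_pos.2 ht0).le hc
  linarith

lemma DefFn.le_zero (h : DefFn Ω U ρ) {q} (hq : q ∈ U) (hc : q ∈ closure Ω) : ρ q ≤ 0 := by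
  have h1 : q ∈ closure (Ω ∩ U) := by
    rw [inter_comm]
    exact h.1.inter_closure ⟨hq, hc⟩
  have h2 : Ω ∩ U ⊆ {q | ρ q ≤ 0} := by
    rw [h.2.2.2]; exact fun q hq => hq.2.le
  exact closure_minimal h2 (isClosed_le h.2.1.continuous continuous_const) h1

lemma DefFn.zero (hΩ : IsOpen Ω) (h : DefFn Ω U ρ) {q} (hq : q ∈ U) (hc : q ∈ frontier Ω) :
    ρ q = 0 := by
  rw [hΩ.frontier_eq] at hc
  have h1 := h.le_zero hq hc.1
  have h2 := hc.2
  rw [h.mem_iff hq] at h2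
  linarith

lemma exists_neg {ℓ : (ℝ × ℝ) →L[ℝ] ℝ} (h : ℓ ≠ 0) : ∃ w, ℓ w < 0 := by
  by_contra! hc
  apply h
  ext <;> simp
  · have h1 := hc (1, 0)
    have h2 := hc (-(1, 0))
    rw [map_neg] at h2
    linarith
  · have h1 := hc (0, 1)
    have h2 := hc (-(0, 1))
    rw [map_neg] at h2
    linarith

lemma DefFn.mem_frontier (hΩ : IsOpen Ω) (h : DefFn Ω U ρ) {q} (hq : q ∈ U) (h0 : ρ q = 0) :
    q ∈ frontier Ω := by
  rw [hΩ.frontier_eq]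
  refine ⟨?_, ?_⟩
  · obtain ⟨w, hw⟩ := exists_neg (h.2.2.1 q hq)
    have h1 := h.near hq h0 hw
    refine mem_closure_of_tendsto (f := fun t : ℝ => q + t • w) (b := 𝓝[>] (0 : ℝ)) ?_ h1
    have : Continuous (fun t : ℝ => q + t • w) := by fun_prop
    have := this.tendsto 0
    simp only [zero_smul, add_zero] at this
    exact this.mono_left nhdsWithin_le_nhds
  · rw [h.mem_iff hq, h0]; simp

lemma DefFn.uniqueDiff (hΩ : IsOpen Ω) (h : DefFn Ω U ρ) {q} (hq : q ∈ U)
    (hc : q ∈ frontier Ω) : UniqueDiffWithinAt ℝ Ω q := by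
  have h0 := h.zero hΩ hq hc
  have key : ∀ v, fderiv ℝ ρ q v < 0 → v ∈ tangentConeAt ℝ Ω q := by
    intro v hv
    have h1 := h.near hq h0 hv
    refine mem_tangentConeAt_of_frequently (𝓝[>] (0 : ℝ)) (fun t => t⁻¹) (fun t => t • v) ?_ ?_ ?_
    · have : Continuous (fun t : ℝ => t • v) := by fun_prop
      have := this.tendsto 0
      simp only [zero_smul] at this
      exact this.mono_left nhdsWithin_le_nhds
    · exact h1.frequently
    · refine Tendsto.congr' ?_ tendsto_const_nhds
      filter_upwards [self_mem_nhdsWithin] with t ht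
      have ht : (0 : ℝ) < t := ht
      rw [smul_smul, inv_mul_cancel₀ ht.ne', one_smul]
  obtain ⟨w, hw⟩ := exists_neg (h.2.2.1 q hq)
  rw [uniqueDiffWithinAt_iff]
  refine ⟨?_, frontier_subset_closure hc⟩
  have : Submodule.span ℝ (tangentConeAt ℝ Ω q) = ⊤ := by
    rw [eq_top_iff]
    rintro v -
    obtain ⟨k, hk⟩ : ∃ k : ℝ, fderiv ℝ ρ q (v + k • w) < 0 := by
      refine ⟨(fderiv ℝ ρ q v + 1) / (- fderiv ℝ ρ q w), ?_⟩
      rw [map_add, map_smul, smul_eq_mul, div_mul_eq_mul_div, mul_div_assoc, div_neg,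
        div_self hw.ne]
      linarith
    have e : v = (v + k • w) - k • w := by simp
    rw [e]
    exact Submodule.sub_mem _ (Submodule.subset_span (key _ hk))
      (Submodule.smul_mem _ _ (Submodule.subset_span (key _ hw)))
  rw [this]
  simp

lemma uniqueDiffOn_closure (hΩ : IsOpen Ω) (hsb : HasSmoothBoundary Ω) :
    UniqueDiffOn ℝ (closure Ω) := by
  intro p hp
  by_cases hpΩ : p ∈ Ω
  · exact (hΩ.uniqueDiffWithinAt hpΩ).mono subset_closure
  · have hf : p ∈ frontier Ω := by rw [hΩ.frontier_eq]; exact ⟨hp, hpΩ⟩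
    obtain ⟨U, ρ, h1, h2, h3, h4, h5⟩ := hsb p hf
    exact (DefFn.uniqueDiff hΩ ⟨h1, h3, h4, h5⟩ h2 hf).mono subset_closure

lemma Tan.fderiv_zero (hΩ : IsOpen Ω) (h : DefFn Ω U ρ) {q} (hq : q ∈ U) {v}
    (hv : Tan Ω q v) : fderiv ℝ ρ q v = 0 := by
  obtain ⟨γ, h1, h2, h3⟩ := hv
  have h4 : HasDerivAt (ρ ∘ γ) (fderiv ℝ ρ q v) 0 := by
    refine HasFDerivAt.comp_hasDerivAt 0 ?_ h3
    rw [h2]; exact (h.diff q).hasFDerivAt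
  have h5 : ρ ∘ γ =ᶠ[𝓝 0] fun _ => 0 := by
    have : ∀ᶠ s in 𝓝 (0 : ℝ), γ s ∈ U := by
      apply h3.continuousAt
      rw [h2]; exact h.1.mem_nhds hq
    filter_upwards [this] with s hs
    exact h.zero hΩ hs (h1 s)
  exact (h4.congr_of_eventuallyEq h5.symm).unique (hasDerivAt_const 0 (0 : ℝ))

lemma Tan.within_zero {ψ : ℝ × ℝ → ℝ} {q v : ℝ × ℝ} (hv : Tan Ω q v)
    (hd : DifferentiableWithinAt ℝ ψ (closure Ω) q) (hz : ∀ p ∈ frontier Ω, ψ p = 0) :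
    fderivWithin ℝ ψ (closure Ω) q v = 0 := by
  obtain ⟨γ, h1, h2, h3⟩ := hv
  have h4 : HasDerivWithinAt (ψ ∘ γ) (fderivWithin ℝ ψ (closure Ω) q v) univ 0 := by
    refine HasFDerivWithinAt.comp_hasDerivWithinAt (t := closure Ω) 0 ?_ h3.hasDerivWithinAt ?_
    · rw [h2]; exact hd.hasFDerivWithinAt
    · exact fun s _ => frontier_subset_closure (h1 s)
  have h5 : ψ ∘ γ = fun _ => 0 := by
    ext s; exact hz _ (h1 s)
  rw [h5, hasDerivWithinAt_univ] at h4
  exact h4.unique (hasDerivAt_const 0 (0 : ℝ))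

lemma tan_of_zero (hΩ : IsOpen Ω) (h : DefFn Ω U ρ) {q} (hq : q ∈ U) (hc : q ∈ frontier Ω) {v}
    (hv : fderiv ℝ ρ q v = 0) : Tan Ω q v := by
  have h0 := h.zero hΩ hq hc
  have hs : HasStrictFDerivAt ρ (fderiv ℝ ρ q) q :=
    h.2.1.contDiffAt.hasStrictFDerivAt (by simp)
  have hr : (fderiv ℝ ρ q).range = ⊤ := by
    obtain ⟨w, hw⟩ := exists_neg (h.2.2.1 q hq)
    rw [eq_top_iff]
    rintro y -
    refine ⟨(y / fderiv ℝ ρ q w) • w, ?_⟩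
    have := hw.ne
    simp
    field_simp
  let V : (fderiv ℝ ρ q).ker := ⟨v, hv⟩
  let c : ℝ → ℝ × ℝ := fun t => hs.implicitFunction ρ _ hr (ρ q) (t • V)
  have hc0 : c 0 = q := by simp [c]
  have hcd : HasDerivAt c v 0 := by
    have h1 := (hs.to_implicitFunction hr).hasFDerivAt
    have h2 : HasDerivAt (fun t : ℝ => t • V) V 0 := by
      simpa using (hasDerivAt_id (0 : ℝ)).smul_const V
    have h3 : HasFDerivAt (hs.implicitFunction ρ _ hr (ρ q)) (fderiv ℝ ρ q).ker.subtypeL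
      ((0 : ℝ) • V) := by simpa using h1
    exact h3.comp_hasDerivAt 0 h2
  have hev : ∀ᶠ t in 𝓝 (0 : ℝ), c t ∈ frontier Ω := by
    have h1 := hs.map_implicitFunction_eq hr
    have h2 : Tendsto (fun t : ℝ => (ρ q, t • V)) (𝓝 0) (𝓝 (ρ q, 0)) := by
      have : Continuous (fun t : ℝ => (ρ q, t • V)) := by fun_prop
      simpa using this.tendsto 0
    have hU : ∀ᶠ t in 𝓝 (0 : ℝ), c t ∈ U := by
      apply hcd.continuousAt
      rw [hc0]; exact h.1.mem_nhds hq
    filter_upwards [h2.eventually h1, hU] with t ht htU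
    exact h.mem_frontier hΩ htU (by rw [← h0]; exact ht)
  classical
  refine ⟨fun t => if c t ∈ frontier Ω then c t else q, ?_, ?_, ?_⟩
  · intro s
    dsimp only
    split_ifs with hh
    · exact hh
    · exact hc
  · simp [hc0]
  · refine hcd.congr_of_eventuallyEq ?_
    filter_upwards [hev] with t ht
    simp [ht]

lemma tan_zero {q} (hc : q ∈ frontier Ω) : Tan Ω q 0 :=
  ⟨fun _ => q, fun _ => hc, rfl, hasDerivAt_const _ _⟩

lemma exists_defFn (hΩ : IsOpen Ω) (hb : Bornology.IsBounded Ω) (hsb : HasSmoothBoundary Ω)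
    {p} (hp : p ∈ closure Ω) : ∃ U ρ, DefFn Ω U ρ ∧ p ∈ U := by
  by_cases hpΩ : p ∈ Ω
  · obtain ⟨M, hM⟩ := hb.exists_norm_le
    refine ⟨Ω, fun q => q.1 - (M + 1), ⟨hΩ, by fun_prop, ?_, ?_⟩, hpΩ⟩
    · intro q _ h
      have h1 : HasFDerivAt (fun q : ℝ × ℝ => q.1 - (M + 1)) (ContinuousLinearMap.fst ℝ ℝ ℝ) q :=
        hasFDerivAt_fst.sub_const _
      rw [h1.fderiv] at h
      have := congrArg (fun L => L (1, 0)) h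
      simp at this
    · ext q
      simp only [inter_self, mem_setOf_eq]
      refine ⟨fun hq => ⟨hq, ?_⟩, fun h => h.1⟩
      have h1 := hM q hq
      have h2 := norm_fst_le q
      have h3 := le_abs_self q.1
      rw [Real.norm_eq_abs] at h2
      linarith
  · have hf : p ∈ frontier Ω := by rw [hΩ.frontier_eq]; exact ⟨hp, hpΩ⟩
    obtain ⟨U, ρ, h1, h2, h3, h4, h5⟩ := hsb p hf
    exact ⟨U, ρ, ⟨h1, h3, h4, h5⟩, h2⟩

lemma int_of_cont {E : Type*} [NormedAddCommGroup E] (hb : Bornology.IsBounded Ω)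
    {g : ℝ × ℝ → E} (hg : ContinuousOn g (closure Ω)) : IntegrableOn g Ω :=
  (hg.integrableOn_compact hb.isCompact_closure).mono_set subset_closure

lemma int_fderiv_compact (hΩ : IsOpen Ω) {K : Set (ℝ × ℝ)} (hK : IsCompact K) (hKΩ : K ⊆ Ω)
    {h : ℝ × ℝ → ℝ} (hh : ContDiffOn ℝ ∞ h Ω) (h0 : ∀ p ∈ Ω, p ∉ K → h p = 0) (v : ℝ × ℝ) :
    IntegrableOn (fun p => fderiv ℝ h p v) Ω ∧ ∫ p in Ω, fderiv ℝ h p v = 0 := by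
  set A : ℝ × ℝ → ℝ := Ω.indicator h with hA
  have hAK : ∀ p, p ∉ K → A p = 0 := by
    intro p hp
    by_cases hpΩ : p ∈ Ω
    · simp [hA, hpΩ, h0 p hpΩ hp]
    · simp [hA, hpΩ]
  have hAe : ∀ p ∈ Ω, A =ᶠ[𝓝 p] h := by
    intro p hp
    filter_upwards [hΩ.mem_nhds hp] with q hq
    simp [hA, hq]
  have hA0 : ∀ p, p ∉ K → A =ᶠ[𝓝 p] fun _ => 0 := by
    intro p hp
    filter_upwards [hK.isClosed.isOpen_compl.mem_nhds hp] with q hq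
    exact hAK q hq
  have hAs : ContDiff ℝ ∞ A := by
    rw [contDiff_iff_contDiffAt]
    intro p
    by_cases hpΩ : p ∈ Ω
    · exact (hh.contDiffAt (hΩ.mem_nhds hpΩ)).congr_of_eventuallyEq (hAe p hpΩ)
    · exact contDiffAt_const.congr_of_eventuallyEq (hA0 p (fun hpK => hpΩ (hKΩ hpK)))
  have hAc : HasCompactSupport A := HasCompactSupport.intro hK hAK
  have hAd : Continuous (fun p => fderiv ℝ A p v) :=
    (hAs.continuous_fderiv (by simp)).clm_apply continuous_const
  have hAdc : HasCompactSupport (fun p => fderiv ℝ A p v) := by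
    refine HasCompactSupport.intro hK (fun p hp => ?_)
    rw [(hA0 p hp).fderiv_eq]; simp
  have hi : Integrable (fun p => fderiv ℝ A p v) volume :=
    hAd.integrable_of_hasCompactSupport hAdc
  have hiA : Integrable A volume := hAs.continuous.integrable_of_hasCompactSupport hAc
  have key := integral_mul_fderiv_eq_neg_fderiv_mul_of_integrable (μ := (volume : Measure (ℝ × ℝ)))
    (f := fun _ : ℝ × ℝ => (1 : ℝ)) (g := A) (v := v) (by simp) (by simpa using hi)
    (by simpa using hiA) (fun x _ => differentiableAt_const _)
    (fun x _ => hAs.differentiable (by simp) x)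
  simp only [one_mul, fderiv_fun_const, Pi.zero_apply, zero_mul, integral_zero, neg_zero,
    ContinuousLinearMap.zero_apply] at key
  have he : EqOn (fun p => fderiv ℝ A p v) (fun p => fderiv ℝ h p v) Ω := by
    intro p hp
    simp only [(hAe p hp).fderiv_eq]
  refine ⟨(hi.integrableOn).congr_fun he hΩ.measurableSet, ?_⟩
  rw [← setIntegral_congr_fun hΩ.measurableSet he,
    setIntegral_eq_integral_of_forall_compl_eq_zero, key]
  intro p hp
  rw [(hA0 p (fun hpK => hp (hKΩ hpK))).fderiv_eq]
  simp

/-- divergence -/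
noncomputable def dv (Ω : Set (ℝ × ℝ)) (P Q : ℝ × ℝ → ℝ) (p : ℝ × ℝ) : ℝ :=
  fderivWithin ℝ P (closure Ω) p (1, 0) + fderivWithin ℝ Q (closure Ω) p (0, 1)

lemma smooth_within {E : Type*} [NormedAddCommGroup E] [NormedSpace ℝ E] {P : ℝ × ℝ → E}
    (hu : UniqueDiffOn ℝ (closure Ω))
    (hP : ContDiffOn ℝ ∞ P (closure Ω)) (v : ℝ × ℝ) :
    ContDiffOn ℝ ∞ (fun p => fderivWithin ℝ P (closure Ω) p v) (closure Ω) :=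
  (hP.fderivWithin hu (by simp)).clm_apply contDiffOn_const

lemma dv_cont (hu : UniqueDiffOn ℝ (closure Ω)) {P Q : ℝ × ℝ → ℝ}
    (hP : ContDiffOn ℝ ∞ P (closure Ω)) (hQ : ContDiffOn ℝ ∞ Q (closure Ω)) :
    ContinuousOn (dv Ω P Q) (closure Ω) :=
  (smooth_within hu hP (1, 0)).continuousOn.add (smooth_within hu hQ (0, 1)).continuousOn

lemma nhds_closure (hΩ : IsOpen Ω) {p} (hp : p ∈ Ω) : closure Ω ∈ 𝓝 p :=
  mem_of_superset (hΩ.mem_nhds hp) subset_closure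

/-- cutoff profile -/
noncomputable def eta (t : ℝ) : ℝ := Real.smoothTransition (t - 1)

lemma eta_smooth : ContDiff ℝ ∞ eta :=
  Real.smoothTransition.contDiff.comp (contDiff_id.sub contDiff_const)

lemma eta_zero {t : ℝ} (h : t ≤ 1) : eta t = 0 :=
  Real.smoothTransition.zero_of_nonpos (by linarith)

lemma eta_one {t : ℝ} (h : 2 ≤ t) : eta t = 1 :=
  Real.smoothTransition.one_of_one_le (by linarith)

lemma eta_nonneg (t : ℝ) : 0 ≤ eta t := Real.smoothTransition.nonneg _
lemma eta_le_one (t : ℝ) : eta t ≤ 1 := Real.smoothTransition.le_one _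

lemma eta_deriv_nonneg (t : ℝ) : 0 ≤ deriv eta t := by
  apply Monotone.deriv_nonneg
  intro a b h
  exact Real.smoothTransition.monotone (by linarith)

lemma eta_deriv_zero {t : ℝ} (h : 2 < t) : deriv eta t = 0 := by
  have : eta =ᶠ[𝓝 t] fun _ => 1 := by
    filter_upwards [lt_mem_nhds h] with s hs
    exact eta_one hs.le
  rw [this.deriv_eq]; simp

lemma fderiv_pair (ρ : ℝ × ℝ → ℝ) (p : ℝ × ℝ) (a b : ℝ) :
    fderiv ℝ ρ p (a, b) = a * fderiv ℝ ρ p (1, 0) + b * fderiv ℝ ρ p (0, 1) := by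
  have : ((a, b) : ℝ × ℝ) = a • (1, 0) + b • (0, 1) := by simp
  rw [this, map_add, map_smul, map_smul]; simp

lemma cut_identity (hΩ : IsOpen Ω) (hb : Bornology.IsBounded Ω)
    (h : DefFn Ω U ρ) {T : Set (ℝ × ℝ)} (hT : IsClosed T) (hTU : T ⊆ U)
    {P Q : ℝ × ℝ → ℝ} (hP : ContDiffOn ℝ ∞ P (closure Ω)) (hQ : ContDiffOn ℝ ∞ Q (closure Ω))
    (hP0 : ∀ p, p ∉ T → P p = 0) (hQ0 : ∀ p, p ∉ T → Q p = 0) {m : ℝ} (hm : 0 < m)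
    (hu : UniqueDiffOn ℝ (closure Ω)) :
    ∫ p in Ω, eta (-(m * ρ p)) * dv Ω P Q p =
      ∫ p in Ω, m * deriv eta (-(m * ρ p)) * fderiv ℝ ρ p (P p, Q p) := by
  have hχ : ContDiff ℝ ∞ (fun p => eta (-(m * ρ p))) :=
    eta_smooth.comp (contDiff_const.mul h.2.1).neg
  set K : Set (ℝ × ℝ) := closure Ω ∩ (T ∩ {p | 1 ≤ -(m * ρ p)}) with hKdef
  have hρc : Continuous ρ := h.2.1.continuous
  have hK : IsCompact K := hb.isCompact_closure.inter_right
    (hT.inter (isClosed_le continuous_const (by fun_prop)))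
  have hKΩ : K ⊆ Ω := by
    rintro p ⟨_, hpT, hp1⟩
    rw [h.mem_iff (hTU hpT)]
    have hp1 : 1 ≤ -(m * ρ p) := hp1
    by_contra hc
    push Not at hc
    have := mul_nonneg hm.le hc
    linarith
  have main : ∀ R : ℝ × ℝ → ℝ, ContDiffOn ℝ ∞ R (closure Ω) → (∀ p, p ∉ T → R p = 0) →
      ∀ v, IntegrableOn (fun p => fderiv ℝ (fun p => eta (-(m * ρ p)) * R p) p v) Ω ∧
        ∫ p in Ω, fderiv ℝ (fun p => eta (-(m * ρ p)) * R p) p v = 0 := by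
    intro R hR hR0 v
    refine int_fderiv_compact hΩ hK hKΩ ?_ ?_ v
    · exact hχ.contDiffOn.mul (hR.mono subset_closure)
    · intro p hp hpK
      by_cases hpT : p ∈ T
      · have : ¬ (1 ≤ -(m * ρ p)) := fun h1 => hpK ⟨subset_closure hp, hpT, h1⟩
        rw [eta_zero (by linarith), zero_mul]
      · rw [hR0 p hpT, mul_zero]
  have form : ∀ R : ℝ × ℝ → ℝ, ContDiffOn ℝ ∞ R (closure Ω) → ∀ v, ∀ p ∈ Ω,
      fderiv ℝ (fun p => eta (-(m * ρ p)) * R p) p v =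
        eta (-(m * ρ p)) * fderivWithin ℝ R (closure Ω) p v
        - m * deriv eta (-(m * ρ p)) * (R p * fderiv ℝ ρ p v) := by
    intro R hR v p hp
    have hn := nhds_closure hΩ hp
    rw [fderivWithin_of_mem_nhds hn]
    have hRd : HasFDerivAt R (fderiv ℝ R p) p :=
      ((hR.contDiffAt hn).differentiableAt (by simp)).hasFDerivAt
    have h1 : HasFDerivAt (fun p => -(m * ρ p)) (-(m • fderiv ℝ ρ p)) p :=
      ((h.diff p).hasFDerivAt.const_mul m).neg
    have h2 : HasDerivAt eta (deriv eta (-(m * ρ p))) (-(m * ρ p)) :=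
      ((eta_smooth.differentiable (by simp)) _).hasDerivAt
    have h3 := (h2.comp_hasFDerivAt p h1).mul hRd
    have h4 : HasFDerivAt (fun p => eta (-(m * ρ p)) * R p) _ p := h3
    rw [h4.fderiv]
    simp
    ring
  obtain ⟨i1, e1⟩ := main P hP hP0 (1, 0)
  obtain ⟨i2, e2⟩ := main Q hQ hQ0 (0, 1)
  have hsum : ∫ p in Ω, (fderiv ℝ (fun p => eta (-(m * ρ p)) * P p) p (1, 0)
      + fderiv ℝ (fun p => eta (-(m * ρ p)) * Q p) p (0, 1)) = 0 := by
    rw [integral_add i1 i2, e1, e2, add_zero]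
  have c1 : ContinuousOn (fun p => eta (-(m * ρ p)) * dv Ω P Q p) (closure Ω) :=
    hχ.continuous.continuousOn.mul (dv_cont hu hP hQ)
  have hρ' : Continuous (fderiv ℝ ρ) := h.2.1.continuous_fderiv (by simp)
  have he' : Continuous (deriv eta) := eta_smooth.continuous_deriv (by simp)
  have c2 : ContinuousOn (fun p => m * deriv eta (-(m * ρ p)) * fderiv ℝ ρ p (P p, Q p))
      (closure Ω) := by
    refine ContinuousOn.mul ?_ ?_
    · exact Continuous.continuousOn (by fun_prop)
    · exact hρ'.continuousOn.clm_apply (hP.continuousOn.prodMk hQ.continuousOn)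
  rw [← sub_eq_zero, ← integral_sub (int_of_cont hb c1) (int_of_cont hb c2), ← hsum]
  refine setIntegral_congr_fun hΩ.measurableSet (fun p hp => ?_)
  simp only [form P hP _ p hp, form Q hQ _ p hp, dv, fderiv_pair ρ p (P p) (Q p)]
  ring

lemma fd_smooth (h : ContDiff ℝ ∞ ρ) (v : ℝ × ℝ) : ContDiff ℝ ∞ (fun p => fderiv ℝ ρ p v) :=
  (h.fderiv_right (by simp)).clm_apply contDiff_const

lemma grad_pos {ℓ : (ℝ × ℝ) →L[ℝ] ℝ} (h : ℓ ≠ 0) : 0 < ℓ (1, 0) ^ 2 + ℓ (0, 1) ^ 2 := by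
  by_contra hc
  apply h
  have h1 : ℓ (1, 0) = 0 := by nlinarith [sq_nonneg (ℓ (1, 0)), sq_nonneg (ℓ (0, 1))]
  have h2 : ℓ (0, 1) = 0 := by nlinarith [sq_nonneg (ℓ (1, 0)), sq_nonneg (ℓ (0, 1))]
  ext <;> simp [h1, h2]

lemma local_div (hΩ : IsOpen Ω) (hb : Bornology.IsBounded Ω) (hu : UniqueDiffOn ℝ (closure Ω))
    (h : DefFn Ω U ρ) {φ : ℝ × ℝ → ℝ} (hφ : ContDiff ℝ ∞ φ) (hφ0 : ∀ p, 0 ≤ φ p)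
    (hφU : tsupport φ ⊆ U)
    {P Q : ℝ × ℝ → ℝ} (hP : ContDiffOn ℝ ∞ P (closure Ω)) (hQ : ContDiffOn ℝ ∞ Q (closure Ω))
    (ht : ∀ q ∈ frontier Ω, Tan Ω q (P q, Q q)) :
    ∫ p in Ω, dv Ω (fun p => φ p * P p) (fun p => φ p * Q p) p = 0 := by
  set T := tsupport φ with hTdef
  have hT : IsClosed T := isClosed_tsupport φ
  have hφT : ∀ p, p ∉ T → φ p = 0 := fun p hp => image_eq_zero_of_notMem_tsupport hp
  set ρx : ℝ × ℝ → ℝ := fun p => fderiv ℝ ρ p (1, 0) with hρx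
  set ρy : ℝ × ℝ → ℝ := fun p => fderiv ℝ ρ p (0, 1) with hρy
  have sx : ContDiff ℝ ∞ ρx := fd_smooth h.2.1 _
  have sy : ContDiff ℝ ∞ ρy := fd_smooth h.2.1 _
  have sP : ContDiffOn ℝ ∞ (fun p => φ p * P p) (closure Ω) := hφ.contDiffOn.mul hP
  have sQ : ContDiffOn ℝ ∞ (fun p => φ p * Q p) (closure Ω) := hφ.contDiffOn.mul hQ
  have gx : ContDiffOn ℝ ∞ (fun p => φ p * ρx p) (closure Ω) := hφ.contDiffOn.mul sx.contDiffOn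
  have gy : ContDiffOn ℝ ∞ (fun p => φ p * ρy p) (closure Ω) := hφ.contDiffOn.mul sy.contDiffOn
  have hρ' : Continuous (fderiv ℝ ρ) := h.2.1.continuous_fderiv (by simp)
  have he' : Continuous (deriv eta) := eta_smooth.continuous_deriv (by simp)
  have hρc : Continuous ρ := h.2.1.continuous
  set C := ∫ p in Ω, |dv Ω (fun p => φ p * ρx p) (fun p => φ p * ρy p) p| with hC
  have iD := int_of_cont hb (dv_cont hu sP sQ)
  have iG := int_of_cont hb (dv_cont hu gx gy)
  have step1 : ∀ δ > 0, ∃ m0 > (0 : ℝ), ∀ m ≥ m0,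
      |∫ p in Ω, eta (-(m * ρ p)) * dv Ω (fun p => φ p * P p) (fun p => φ p * Q p) p| ≤ δ * C := by
    intro δ hδ
    set g : ℝ × ℝ → ℝ := fun p => |fderiv ℝ ρ p (P p, Q p)| - δ * (ρx p ^ 2 + ρy p ^ 2) with hg
    have gc : ContinuousOn g (closure Ω) := by
      refine ContinuousOn.sub ?_ ?_
      · exact (hρ'.continuousOn.clm_apply (hP.continuousOn.prodMk hQ.continuousOn)).abs
      · have := sx.continuous
        have := sy.continuous
        exact Continuous.continuousOn (by fun_prop)
    set Bd := (closure Ω ∩ T) ∩ g ⁻¹' (Ici 0) with hBd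
    have hBdc : IsCompact Bd :=
      (hb.isCompact_closure.inter_right hT).of_isClosed_subset
        ((gc.mono inter_subset_left).preimage_isClosed_of_isClosed
          (isClosed_closure.inter hT) isClosed_Ici) inter_subset_left
    have hneg : ∀ p ∈ Bd, ρ p < 0 := by
      rintro p ⟨⟨hp1, hp2⟩, hp3⟩
      have hpU := hφU hp2
      rcases (h.le_zero hpU hp1).lt_or_eq with h1 | h1
      · exact h1
      · exfalso
        have hfr := h.mem_frontier hΩ hpU h1
        have h2 := (ht p hfr).fderiv_zero hΩ h hpU
        have h3 : 0 < ρx p ^ 2 + ρy p ^ 2 := grad_pos (h.2.2.1 p hpU)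
        have h4 : 0 ≤ g p := hp3
        simp only [hg, h2, abs_zero] at h4
        nlinarith
    obtain ⟨b, hb0, hbd⟩ : ∃ b > 0, ∀ p ∈ Bd, ρ p ≤ -b := by
      rcases Bd.eq_empty_or_nonempty with he | hne
      · exact ⟨1, one_pos, by simp [he]⟩
      · obtain ⟨p0, hp0, hmax⟩ := hBdc.exists_isMaxOn hne hρc.continuousOn
        refine ⟨-ρ p0, by linarith [hneg p0 hp0], fun p hp => ?_⟩
        have := hmax hp
        simp only [mem_setOf_eq] at this
        linarith
    refine ⟨3 / b, by positivity, fun m hm => ?_⟩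
    have hm0 : 0 < m := lt_of_lt_of_le (by positivity) hm
    have hmb : 3 ≤ m * b := by
      have := (div_le_iff₀ hb0).1 hm
      linarith
    rw [cut_identity hΩ hb h hT hφU sP sQ (fun p hp => by simp [hφT p hp])
      (fun p hp => by simp [hφT p hp]) hm0 hu]
    have id2 := cut_identity hΩ hb h hT hφU gx gy (fun p hp => by simp [hφT p hp])
      (fun p hp => by simp [hφT p hp]) hm0 hu
    have cG : ContinuousOn (fun p => m * deriv eta (-(m * ρ p)) *
        fderiv ℝ ρ p (φ p * ρx p, φ p * ρy p)) (closure Ω) := by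
      refine ContinuousOn.mul ?_ ?_
      · exact Continuous.continuousOn (by fun_prop)
      · exact hρ'.continuousOn.clm_apply (gx.continuousOn.prodMk gy.continuousOn)
    have b1 : |∫ p in Ω, m * deriv eta (-(m * ρ p)) * fderiv ℝ ρ p (φ p * P p, φ p * Q p)| ≤
        ∫ p in Ω, δ * (m * deriv eta (-(m * ρ p)) *
          fderiv ℝ ρ p (φ p * ρx p, φ p * ρy p)) := by
      rw [← Real.norm_eq_abs]
      refine norm_integral_le_of_norm_le ((int_of_cont hb cG).const_mul δ) ?_
      rw [ae_restrict_iff' hΩ.measurableSet]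
      refine Eventually.of_forall (fun p hp => ?_)
      rw [Real.norm_eq_abs]
      have e1 : fderiv ℝ ρ p (φ p * P p, φ p * Q p) = φ p * fderiv ℝ ρ p (P p, Q p) := by
        rw [fderiv_pair, fderiv_pair ρ p (P p)]; ring
      have e2 : fderiv ℝ ρ p (φ p * ρx p, φ p * ρy p) = φ p * (ρx p ^ 2 + ρy p ^ 2) := by
        rw [fderiv_pair]; ring
      rw [e1, e2]
      by_cases hpT : p ∈ T
      · by_cases hpB : p ∈ Bd
        · have h1 : deriv eta (-(m * ρ p)) = 0 := by
            apply eta_deriv_zero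
            nlinarith [hbd p hpB]
          simp [h1]
        · have h1 : g p < 0 := by
            by_contra hc
            exact hpB ⟨⟨subset_closure hp, hpT⟩, not_lt.1 hc⟩
          simp only [hg] at h1
          have h2 := eta_deriv_nonneg (-(m * ρ p))
          have h3 : 0 ≤ m * deriv eta (-(m * ρ p)) * φ p :=
            mul_nonneg (mul_nonneg hm0.le h2) (hφ0 p)
          rw [← mul_assoc, abs_mul, abs_of_nonneg h3]
          calc _ ≤ m * deriv eta (-(m * ρ p)) * φ p * (δ * (ρx p ^ 2 + ρy p ^ 2)) :=
                mul_le_mul_of_nonneg_left (by linarith) h3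
            _ = _ := by ring
      · simp [hφT p hpT]
    refine b1.trans ?_
    rw [integral_const_mul, ← id2]
    refine mul_le_mul_of_nonneg_left ?_ hδ.le
    have cE : ContinuousOn (fun p => eta (-(m * ρ p)) *
        dv Ω (fun p => φ p * ρx p) (fun p => φ p * ρy p) p) (closure Ω) := by
      refine ContinuousOn.mul ?_ (dv_cont hu gx gy)
      have := eta_smooth.continuous
      exact Continuous.continuousOn (by fun_prop)
    refine integral_mono (int_of_cont hb cE) iG.abs (fun p => ?_)
    dsimp only
    have h1 := eta_nonneg (-(m * ρ p))
    have h2 := eta_le_one (-(m * ρ p))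
    calc _ ≤ |eta (-(m * ρ p)) * dv Ω (fun p => φ p * ρx p) (fun p => φ p * ρy p) p| :=
          le_abs_self _
      _ = eta (-(m * ρ p)) * |dv Ω (fun p => φ p * ρx p) (fun p => φ p * ρy p) p| := by
          rw [abs_mul, abs_of_nonneg h1]
      _ ≤ 1 * |dv Ω (fun p => φ p * ρx p) (fun p => φ p * ρy p) p| :=
          mul_le_mul_of_nonneg_right h2 (abs_nonneg _)
      _ = _ := one_mul _
  have step2 : Tendsto (fun n : ℕ => ∫ p in Ω, eta (-((n : ℝ) * ρ p)) *
      dv Ω (fun p => φ p * P p) (fun p => φ p * Q p) p) atTop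
      (𝓝 (∫ p in Ω, dv Ω (fun p => φ p * P p) (fun p => φ p * Q p) p)) := by
    refine tendsto_integral_of_dominated_convergence
      (fun p => |dv Ω (fun p => φ p * P p) (fun p => φ p * Q p) p|) ?_ iD.abs ?_ ?_
    · intro n
      have cE : ContinuousOn (fun p => eta (-((n : ℝ) * ρ p)) *
          dv Ω (fun p => φ p * P p) (fun p => φ p * Q p) p) (closure Ω) := by
        refine ContinuousOn.mul ?_ (dv_cont hu sP sQ)
        have := eta_smooth.continuous
        exact Continuous.continuousOn (by fun_prop)
      exact (int_of_cont hb cE).aestronglyMeasurable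
    · intro n
      refine Eventually.of_forall (fun p => ?_)
      rw [Real.norm_eq_abs, abs_mul, abs_of_nonneg (eta_nonneg _)]
      exact mul_le_of_le_one_left (abs_nonneg _) (eta_le_one _)
    · rw [ae_restrict_iff' hΩ.measurableSet]
      refine Eventually.of_forall (fun p hp => ?_)
      by_cases hpT : p ∈ T
      · have hneg : ρ p < 0 := (h.mem_iff (hφU hpT)).1 hp
        refine tendsto_const_nhds.congr' ?_
        filter_upwards [eventually_ge_atTop (Nat.ceil (2 / (-ρ p)))] with n hn
        have h1 : 2 / (-ρ p) ≤ n := Nat.ceil_le.1 hn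
        rw [div_le_iff₀ (by linarith)] at h1
        rw [eta_one (by linarith), one_mul]
      · have hz : ∀ R : ℝ × ℝ → ℝ, ∀ v,
            fderivWithin ℝ (fun p => φ p * R p) (closure Ω) p v = 0 := by
          intro R v
          rw [fderivWithin_of_mem_nhds (nhds_closure hΩ hp)]
          have : (fun p => φ p * R p) =ᶠ[𝓝 p] fun _ => 0 := by
            filter_upwards [hT.isOpen_compl.mem_nhds hpT] with q hq
            simp [hφT q hq]
          rw [this.fderiv_eq]; simp
        have : dv Ω (fun p => φ p * P p) (fun p => φ p * Q p) p = 0 := by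
          simp only [dv, hz, add_zero]
        simp [this]
  have hC0 : 0 ≤ C := integral_nonneg (fun _ => abs_nonneg _)
  have fin : ∀ δ > 0, |∫ p in Ω, dv Ω (fun p => φ p * P p) (fun p => φ p * Q p) p| ≤ δ * C := by
    intro δ hδ
    obtain ⟨m0, hm0, hm⟩ := step1 δ hδ
    refine le_of_tendsto step2.abs ?_
    filter_upwards [eventually_ge_atTop (Nat.ceil m0)] with n hn
    exact hm n (Nat.ceil_le.1 hn)
  have : |∫ p in Ω, dv Ω (fun p => φ p * P p) (fun p => φ p * Q p) p| ≤ 0 := by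
    refine le_of_forall_pos_le_add (fun ε hε => ?_)
    have := fin (ε / (C + 1)) (by positivity)
    refine this.trans ?_
    rw [zero_add, div_mul_eq_mul_div, div_le_iff₀ (by positivity)]
    nlinarith
  exact abs_nonpos_iff.1 this

lemma div_zero (hΩ : IsOpen Ω) (hb : Bornology.IsBounded Ω) (hsb : HasSmoothBoundary Ω)
    {P Q : ℝ × ℝ → ℝ} (hP : ContDiffOn ℝ ∞ P (closure Ω)) (hQ : ContDiffOn ℝ ∞ Q (closure Ω))
    (ht : ∀ q ∈ frontier Ω, Tan Ω q (P q, Q q)) :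
    ∫ p in Ω, dv Ω P Q p = 0 := by
  have hu := uniqueDiffOn_closure hΩ hsb
  choose! V σ hV using fun p (hp : p ∈ closure Ω) => exists_defFn hΩ hb hsb hp
  obtain ⟨t, hts, htc⟩ := hb.isCompact_closure.elim_nhds_subcover V
    (fun p hp => (hV p hp).1.1.mem_nhds (hV p hp).2)
  obtain ⟨f, hf⟩ := SmoothPartitionOfUnity.exists_isSubordinate (modelWithCornersSelf ℝ (ℝ × ℝ))
    (isClosed_closure (s := Ω)) (fun i : t => V i) (fun i => (hV i (hts i i.2)).1.1)
    (by simpa [iUnion_subtype] using htc)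
  have hsm : ∀ i, ContDiff ℝ ∞ (fun p => f i p) := fun i => (f i).contMDiff.contDiff
  have hone : ∀ p ∈ closure Ω, ∑ i, f i p = 1 := by
    intro p hp
    rw [← finsum_eq_sum_of_fintype]
    exact f.sum_eq_one hp
  have hdiff : ∀ R : ℝ × ℝ → ℝ, ContDiffOn ℝ ∞ R (closure Ω) → ∀ p ∈ closure Ω, ∀ v,
      fderivWithin ℝ R (closure Ω) p v
        = ∑ i, fderivWithin ℝ (fun p => f i p * R p) (closure Ω) p v := by
    intro R hR p hp v
    have h1 : EqOn R (fun p => ∑ i, f i p * R p) (closure Ω) := by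
      intro q hq
      simp only [← Finset.sum_mul, hone q hq, one_mul]
    rw [fderivWithin_congr h1 (h1 hp), fderivWithin_fun_sum (hu p hp)]
    · simp
    · intro i _
      exact (((hsm i).contDiffOn.mul hR).differentiableOn (by simp)) p hp
  have e : EqOn (dv Ω P Q) (fun p => ∑ i, dv Ω (fun p => f i p * P p) (fun p => f i p * Q p) p)
      Ω := by
    intro p hp
    simp only [dv, hdiff P hP p (subset_closure hp), hdiff Q hQ p (subset_closure hp),
      Finset.sum_add_distrib]
  rw [setIntegral_congr_fun hΩ.measurableSet e, integral_finsetSum]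
  · refine Finset.sum_eq_zero (fun i _ => ?_)
    exact local_div hΩ hb hu (hV i (hts i i.2)).1 (hsm i) (fun p => f.nonneg i p) (hf i) hP hQ ht
  · intro i _
    exact int_of_cont hb (dv_cont hu ((hsm i).contDiffOn.mul hP) ((hsm i).contDiffOn.mul hQ))

lemma dz_smooth (hu : UniqueDiffOn ℝ (closure Ω)) {W : ℝ × ℝ → ℂ}
    (hW : ContDiffOn ℝ ∞ W (closure Ω)) : ContDiffOn ℝ ∞ (dzbarW Ω W) (closure Ω) := by
  unfold dzbarW pdxW pdyW
  exact contDiffOn_const.mul ((smooth_within hu hW _).add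
    (contDiffOn_const.mul (smooth_within hu hW _)))

lemma dot_smooth {S : Set (ℝ × ℝ)} {a b : ℝ × ℝ → ℝ × ℝ} (ha : ContDiffOn ℝ ∞ a S)
    (hb : ContDiffOn ℝ ∞ b S) : ContDiffOn ℝ ∞ (fun p => dot (a p) (b p)) S := by
  unfold dot
  exact (ha.fst.mul hb.fst).add (ha.snd.mul hb.snd)

lemma ofReal_smooth {S : Set (ℝ × ℝ)} {a : ℝ × ℝ → ℝ} (ha : ContDiffOn ℝ ∞ a S) :
    ContDiffOn ℝ ∞ (fun p => ((a p : ℝ) : ℂ)) S :=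
  Complex.ofRealCLM.contDiff.comp_contDiffOn ha

lemma hopf_smooth (hu : UniqueDiffOn ℝ (closure Ω)) {Φ : ℝ × ℝ → ℝ × ℝ}
    (hΦ : ContDiffOn ℝ ∞ Φ (closure Ω)) : ContDiffOn ℝ ∞ (hopfW Ω Φ) (closure Ω) := by
  have hx : ContDiffOn ℝ ∞ (pdxW (closure Ω) Φ) (closure Ω) := smooth_within hu hΦ _
  have hy : ContDiffOn ℝ ∞ (pdyW (closure Ω) Φ) (closure Ω) := smooth_within hu hΦ _
  unfold hopfW
  exact (ofReal_smooth ((dot_smooth hy hy).sub (dot_smooth hx hx))).add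
    (contDiffOn_const.mul (ofReal_smooth (dot_smooth hx hy)))

lemma re_smooth {S : Set (ℝ × ℝ)} {a : ℝ × ℝ → ℂ} (ha : ContDiffOn ℝ ∞ a S) :
    ContDiffOn ℝ ∞ (fun p => (a p).re) S := Complex.reCLM.contDiff.comp_contDiffOn ha

lemma im_smooth {S : Set (ℝ × ℝ)} {a : ℝ × ℝ → ℂ} (ha : ContDiffOn ℝ ∞ a S) :
    ContDiffOn ℝ ∞ (fun p => (a p).im) S := Complex.imCLM.contDiff.comp_contDiffOn ha

lemma dz_im (hu : UniqueDiffOn ℝ (closure Ω)) {W : ℝ × ℝ → ℂ}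
    (hW : ContDiffOn ℝ ∞ W (closure Ω)) {p} (hp : p ∈ closure Ω) :
    (dzbarW Ω W p).im = dv Ω (fun p => (1 / 2) * (W p).im) (fun p => (1 / 2) * (W p).re) p := by
  have h0 := (hW.differentiableOn (by simp) p hp).hasFDerivWithinAt
  have h1 : HasFDerivWithinAt (fun p => (1 / 2) * (W p).im) _ (closure Ω) p :=
    (Complex.imCLM.hasFDerivAt.comp_hasFDerivWithinAt p h0).const_mul (1 / 2)
  have h2 : HasFDerivWithinAt (fun p => (1 / 2) * (W p).re) _ (closure Ω) p :=
    (Complex.reCLM.hasFDerivAt.comp_hasFDerivWithinAt p h0).const_mul (1 / 2)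
  simp only [dv, h1.fderivWithin (hu p hp), h2.fderivWithin (hu p hp), dzbarW, pdxW, pdyW]
  simp
  ring

lemma dz_mul (hu : UniqueDiffOn ℝ (closure Ω)) {f g : ℝ × ℝ → ℂ}
    (hf : ContDiffOn ℝ ∞ f (closure Ω)) (hg : ContDiffOn ℝ ∞ g (closure Ω)) {p}
    (hp : p ∈ closure Ω) :
    dzbarW Ω (fun p => f p * g p) p = dzbarW Ω f p * g p + f p * dzbarW Ω g p := by
  have h1 := hf.differentiableOn (by simp) p hp
  have h2 := hg.differentiableOn (by simp) p hp
  simp only [dzbarW, pdxW, pdyW, fderivWithin_fun_mul (hu p hp) h1 h2]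
  simp
  ring

lemma dz_sub (hu : UniqueDiffOn ℝ (closure Ω)) {f g : ℝ × ℝ → ℂ}
    (hf : ContDiffOn ℝ ∞ f (closure Ω)) (hg : ContDiffOn ℝ ∞ g (closure Ω)) {p}
    (hp : p ∈ closure Ω) :
    dzbarW Ω (fun p => f p - g p) p = dzbarW Ω f p - dzbarW Ω g p := by
  have h1 := hf.differentiableOn (by simp) p hp
  have h2 := hg.differentiableOn (by simp) p hp
  simp only [dzbarW, pdxW, pdyW, fderivWithin_fun_sub (hu p hp) h1 h2]
  simp
  ring

/-- the flux function -/
noncomputable def WW (Ω : Set (ℝ × ℝ)) (f : ℝ × ℝ → ℂ) (ψ : ℝ × ℝ → ℝ) (p : ℝ × ℝ) : ℂ :=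
  f p * dzbarW Ω (fun q => ((ψ q : ℝ) : ℂ)) p - ((ψ p : ℝ) : ℂ) * dzbarW Ω f p

lemma WW_smooth (hu : UniqueDiffOn ℝ (closure Ω)) {f : ℝ × ℝ → ℂ} {ψ : ℝ × ℝ → ℝ}
    (hf : ContDiffOn ℝ ∞ f (closure Ω)) (hψ : ContDiffOn ℝ ∞ ψ (closure Ω)) :
    ContDiffOn ℝ ∞ (WW Ω f ψ) (closure Ω) :=
  (hf.mul (dz_smooth hu (ofReal_smooth hψ))).sub ((ofReal_smooth hψ).mul (dz_smooth hu hf))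

/-- flux components -/
noncomputable def PP (Ω : Set (ℝ × ℝ)) (f : ℝ × ℝ → ℂ) (ψ : ℝ × ℝ → ℝ) (p : ℝ × ℝ) : ℝ :=
  (1 / 2) * (WW Ω f ψ p).im
/-- flux components -/
noncomputable def QQ (Ω : Set (ℝ × ℝ)) (f : ℝ × ℝ → ℂ) (ψ : ℝ × ℝ → ℝ) (p : ℝ × ℝ) : ℝ :=
  (1 / 2) * (WW Ω f ψ p).re

lemma PP_smooth (hu : UniqueDiffOn ℝ (closure Ω)) {f : ℝ × ℝ → ℂ} {ψ : ℝ × ℝ → ℝ}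
    (hf : ContDiffOn ℝ ∞ f (closure Ω)) (hψ : ContDiffOn ℝ ∞ ψ (closure Ω)) :
    ContDiffOn ℝ ∞ (PP Ω f ψ) (closure Ω) :=
  contDiffOn_const.mul (im_smooth (WW_smooth hu hf hψ))

lemma QQ_smooth (hu : UniqueDiffOn ℝ (closure Ω)) {f : ℝ × ℝ → ℂ} {ψ : ℝ × ℝ → ℝ}
    (hf : ContDiffOn ℝ ∞ f (closure Ω)) (hψ : ContDiffOn ℝ ∞ ψ (closure Ω)) :
    ContDiffOn ℝ ∞ (QQ Ω f ψ) (closure Ω) :=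
  contDiffOn_const.mul (re_smooth (WW_smooth hu hf hψ))

lemma green (hu : UniqueDiffOn ℝ (closure Ω)) {f : ℝ × ℝ → ℂ} {ψ : ℝ × ℝ → ℝ}
    (hf : ContDiffOn ℝ ∞ f (closure Ω)) (hψ : ContDiffOn ℝ ∞ ψ (closure Ω)) {p}
    (hp : p ∈ closure Ω) :
    (f p * dzbarW Ω (dzbarW Ω (fun q => ((ψ q : ℝ) : ℂ))) p).im =
      ψ p * (dzbarW Ω (dzbarW Ω f) p).im + dv Ω (PP Ω f ψ) (QQ Ω f ψ) p := by
  have sΨ := ofReal_smooth hψ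
  have h1 := dz_im hu (WW_smooth hu hf hψ) hp
  have h2 : dzbarW Ω (WW Ω f ψ) p = f p * dzbarW Ω (dzbarW Ω (fun q => ((ψ q : ℝ) : ℂ))) p
      - (ψ p : ℂ) * dzbarW Ω (dzbarW Ω f) p := by
    unfold WW
    rw [dz_sub hu (hf.mul (dz_smooth hu sΨ)) (sΨ.mul (dz_smooth hu hf)) hp,
      dz_mul hu hf (dz_smooth hu sΨ) hp, dz_mul hu sΨ (dz_smooth hu hf) hp]
    ring
  rw [h2, Complex.sub_im, Complex.im_ofReal_mul] at h1
  change _ = dv Ω (PP Ω f ψ) (QQ Ω f ψ) p at h1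
  linarith

lemma green_int (hΩ : IsOpen Ω) (hb : Bornology.IsBounded Ω) (hu : UniqueDiffOn ℝ (closure Ω))
    {f : ℝ × ℝ → ℂ} {ψ : ℝ × ℝ → ℝ}
    (hf : ContDiffOn ℝ ∞ f (closure Ω)) (hψ : ContDiffOn ℝ ∞ ψ (closure Ω)) :
    (∫ p in Ω, f p * dzbarW Ω (dzbarW Ω (fun q => ((ψ q : ℝ) : ℂ))) p).im =
      (∫ p in Ω, ψ p * (dzbarW Ω (dzbarW Ω f) p).im)
        + ∫ p in Ω, dv Ω (PP Ω f ψ) (QQ Ω f ψ) p := by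
  have c1 := hf.mul (dz_smooth hu (dz_smooth hu (ofReal_smooth hψ)))
  have c2 := hψ.mul (im_smooth (dz_smooth hu (dz_smooth hu hf)))
  have i1 := int_of_cont hb c1.continuousOn
  have i2 := int_of_cont hb c2.continuousOn
  have i3 := int_of_cont hb (dv_cont hu (PP_smooth hu hf hψ) (QQ_smooth hu hf hψ))
  have e1 := Complex.imCLM.integral_comp_comm i1
  simp only [Complex.imCLM_apply] at e1
  rw [← e1, ← integral_add i2 i3]
  exact setIntegral_congr_fun hΩ.measurableSet (fun p hp => green hu hf hψ (subset_closure hp))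

lemma dz_real (hu : UniqueDiffOn ℝ (closure Ω)) {ψ : ℝ × ℝ → ℝ} {p}
    (hp : p ∈ closure Ω) (hψ : DifferentiableWithinAt ℝ ψ (closure Ω) p) :
    dzbarW Ω (fun q => ((ψ q : ℝ) : ℂ)) p = (1 / 2 : ℂ) *
      ((fderivWithin ℝ ψ (closure Ω) p (1, 0) : ℝ) +
        Complex.I * (fderivWithin ℝ ψ (closure Ω) p (0, 1) : ℝ)) := by
  have h1 : HasFDerivWithinAt (fun q => ((ψ q : ℝ) : ℂ)) _ (closure Ω) p :=
    Complex.ofRealCLM.hasFDerivAt.comp_hasFDerivWithinAt p hψ.hasFDerivWithinAt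
  simp only [dzbarW, pdxW, pdyW, h1.fderivWithin (hu p hp)]
  simp

lemma PP_bd (hu : UniqueDiffOn ℝ (closure Ω)) {f : ℝ × ℝ → ℂ} {ψ : ℝ × ℝ → ℝ} {p}
    (hp : p ∈ closure Ω) (hψ : DifferentiableWithinAt ℝ ψ (closure Ω) p) (h0 : ψ p = 0) :
    PP Ω f ψ p = (1 / 4) * ((f p).re * fderivWithin ℝ ψ (closure Ω) p (0, 1) +
      (f p).im * fderivWithin ℝ ψ (closure Ω) p (1, 0)) := by
  simp only [PP, WW, dz_real hu hp hψ, h0]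
  simp
  ring

lemma QQ_bd (hu : UniqueDiffOn ℝ (closure Ω)) {f : ℝ × ℝ → ℂ} {ψ : ℝ × ℝ → ℝ} {p}
    (hp : p ∈ closure Ω) (hψ : DifferentiableWithinAt ℝ ψ (closure Ω) p) (h0 : ψ p = 0) :
    QQ Ω f ψ p = (1 / 4) * ((f p).re * fderivWithin ℝ ψ (closure Ω) p (1, 0) -
      (f p).im * fderivWithin ℝ ψ (closure Ω) p (0, 1)) := by
  simp only [QQ, WW, dz_real hu hp hψ, h0]
  simp
  ring

lemma area (hΩ : IsOpen Ω) {Ω₁ : Set (ℝ × ℝ)} {Φ : ℝ × ℝ → ℝ × ℝ} (hΦ : IsAPD Ω Ω₁ Φ) :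
    volume Ω = volume Ω₁ := by
  obtain ⟨h1, h2, h3, h4⟩ := hΦ
  have hd : ∀ x ∈ Ω, HasFDerivWithinAt Φ (fderiv ℝ Φ x) Ω x := fun x hx =>
    ((h1.contDiffAt (nhds_closure hΩ hx)).differentiableAt
      (by simp)).hasFDerivAt.hasFDerivWithinAt
  have := lintegral_abs_det_fderiv_eq_addHaar_image volume hΩ.measurableSet hd h2
  rw [h3] at this
  rw [← this]
  have e : EqOn (fun x => ENNReal.ofReal |(fderiv ℝ Φ x).det|) (fun _ => 1) Ω := by
    intro x hx
    have h5 := h4 x hx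
    simp only [pdxW, pdyW, fderivWithin_of_mem_nhds (nhds_closure hΩ hx), dot] at h5
    have hdet : (fderiv ℝ Φ x).det = (fderiv ℝ Φ x (1, 0)).1 * (fderiv ℝ Φ x (0, 1)).2
        - (fderiv ℝ Φ x (0, 1)).1 * (fderiv ℝ Φ x (1, 0)).2 := by
      rw [ContinuousLinearMap.det, ← LinearMap.det_toMatrix (Module.Basis.finTwoProd ℝ),
        Matrix.det_fin_two]
      simp [LinearMap.toMatrix_apply]
    have : |(fderiv ℝ Φ x).det| = 1 := by
      have h6 : (fderiv ℝ Φ x).det ^ 2 = 1 := by rw [hdet]; linear_combination h5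
      have h7 := sq_abs (fderiv ℝ Φ x).det
      have h8 := abs_nonneg (fderiv ℝ Φ x).det
      nlinarith
    simp [this]
  rw [setLIntegral_congr_fun hΩ.measurableSet e]
  simp

lemma clm_pair (ℓ : (ℝ × ℝ) →L[ℝ] ℝ) (a b : ℝ) : ℓ (a, b) = a * ℓ (1, 0) + b * ℓ (0, 1) := by
  have : ((a, b) : ℝ × ℝ) = a • (1, 0) + b • (0, 1) := by simp
  rw [this, map_add, map_smul, map_smul]; simp

lemma backward (hΩ : IsOpen Ω) (hb : Bornology.IsBounded Ω) (hsb : HasSmoothBoundary Ω)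
    {f : ℝ × ℝ → ℂ} {ψ : ℝ × ℝ → ℝ}
    (hf : ContDiffOn ℝ ∞ f (closure Ω)) (hψ : ContDiffOn ℝ ∞ ψ (closure Ω))
    (hψ0 : ∀ p ∈ frontier Ω, ψ p = 0)
    (h1 : ∀ p ∈ Ω, (dzbarW Ω (dzbarW Ω f) p).im = 0)
    (h2 : ∀ z ∈ frontier Ω, ∀ τ : ℂ, IsUnitTangent Ω z τ → (f z * τ ^ 2).im = 0) :
    (∫ p in Ω, f p * dzbarW Ω (dzbarW Ω (fun q => ((ψ q : ℝ) : ℂ))) p).im = 0 := by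
  have hu := uniqueDiffOn_closure hΩ hsb
  rw [green_int hΩ hb hu hf hψ, div_zero hΩ hb hsb (PP_smooth hu hf hψ) (QQ_smooth hu hf hψ),
    add_zero]
  · rw [setIntegral_congr_fun (g := fun _ => (0 : ℝ)) hΩ.measurableSet]
    · simp
    · intro p hp
      simp [h1 p hp]
  · intro q hq
    have hqc : q ∈ closure Ω := frontier_subset_closure hq
    have hd : DifferentiableWithinAt ℝ ψ (closure Ω) q := hψ.differentiableOn (by simp) q hqc
    obtain ⟨V, σ, hσ, hqV⟩ := exists_defFn hΩ hb hsb hqc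
    have hN := grad_pos (hσ.2.2.1 q hqV)
    have e1 : fderivWithin ℝ ψ (closure Ω) q (-fderiv ℝ σ q (0, 1), fderiv ℝ σ q (1, 0)) = 0 := by
      refine Tan.within_zero (tan_of_zero hΩ hσ hqV hq ?_) hd hψ0
      rw [fderiv_pair]; ring
    have e1' : -fderiv ℝ σ q (0, 1) * fderivWithin ℝ ψ (closure Ω) q (1, 0)
        + fderiv ℝ σ q (1, 0) * fderivWithin ℝ ψ (closure Ω) q (0, 1) = 0 := by
      rw [clm_pair] at e1; exact e1
    apply tan_of_zero hΩ hσ hqV hq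
    rw [fderiv_pair, PP_bd hu hqc hd (hψ0 q hq), QQ_bd hu hqc hd (hψ0 q hq)]
    set a := fderiv ℝ σ q (1, 0) with ha
    set b := fderiv ℝ σ q (0, 1) with hb'
    set X := fderivWithin ℝ ψ (closure Ω) q (1, 0)
    set Y := fderivWithin ℝ ψ (closure Ω) q (0, 1)
    set r := Real.sqrt (a ^ 2 + b ^ 2) with hr
    have hr0 : 0 < r := Real.sqrt_pos.2 hN
    have hr2 : r ^ 2 = a ^ 2 + b ^ 2 := Real.sq_sqrt hN.le
    have e2 := h2 q hq ⟨-b / r, a / r⟩ ⟨by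
        rw [Complex.norm_eq_sqrt_sq_add_sq, Real.sqrt_eq_one]
        field_simp
        linarith, by
        refine tan_of_zero hΩ hσ hqV hq ?_
        rw [fderiv_pair, ← ha, ← hb']; field_simp; ring⟩
    have e3 : (f q).re * (-2 * a * b) + (f q).im * (b ^ 2 - a ^ 2) = 0 := by
      simp only [sq, Complex.mul_im, Complex.mul_re] at e2
      field_simp at e2
      linear_combination e2
    have e4 : (a ^ 2 + b ^ 2) * (1 / 4 * ((f q).re * Y + (f q).im * X) * a
        + 1 / 4 * ((f q).re * X - (f q).im * Y) * b) = 0 := by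
      linear_combination (1 / 4) * (-(a * X + b * Y)) * e3 +
        (1 / 4) * ((f q).re * (a ^ 2 - b ^ 2) - 2 * a * b * (f q).im) * e1'
    have := (mul_eq_zero.1 e4).resolve_left hN.ne'
    linarith

lemma cond_one (hΩ : IsOpen Ω) (hb : Bornology.IsBounded Ω) (hsb : HasSmoothBoundary Ω)
    {f : ℝ × ℝ → ℂ} (hf : ContDiffOn ℝ ∞ f (closure Ω))
    (H : ∀ ψ : ℝ × ℝ → ℝ, ContDiffOn ℝ ∞ ψ (closure Ω) → (∀ p ∈ frontier Ω, ψ p = 0) →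
      (∫ p in Ω, f p * dzbarW Ω (dzbarW Ω (fun q => ((ψ q : ℝ) : ℂ))) p).im = 0) :
    ∀ p ∈ Ω, (dzbarW Ω (dzbarW Ω f) p).im = 0 := by
  have hu := uniqueDiffOn_closure hΩ hsb
  have hc : ContinuousOn (fun p => (dzbarW Ω (dzbarW Ω f) p).im) (closure Ω) :=
    (im_smooth (dz_smooth hu (dz_smooth hu hf))).continuousOn
  have hcΩ := hc.mono subset_closure
  have key : ∀ᵐ x ∂(volume : Measure (ℝ × ℝ)), x ∈ Ω → (dzbarW Ω (dzbarW Ω f) x).im = 0 := by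
    refine hΩ.ae_eq_zero_of_integral_contDiff_smul_eq_zero
      (hcΩ.locallyIntegrableOn hΩ.measurableSet) ?_
    intro g hg hgc hgs
    have hfr : ∀ q ∈ frontier Ω, q ∉ tsupport g := by
      intro q hq hq'
      rw [hΩ.frontier_eq] at hq
      exact hq.2 (hgs hq')
    have h0 : ∀ q ∈ frontier Ω, g q = 0 := fun q hq => image_eq_zero_of_notMem_tsupport (hfr q hq)
    have h1 := H g hg.contDiffOn h0
    rw [green_int hΩ hb hu hf hg.contDiffOn, div_zero hΩ hb hsb (PP_smooth hu hf hg.contDiffOn)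
      (QQ_smooth hu hf hg.contDiffOn), add_zero] at h1
    · rw [← setIntegral_eq_integral_of_forall_compl_eq_zero (s := Ω)]
      · simpa using h1
      · intro x hx
        rw [image_eq_zero_of_notMem_tsupport (fun h => hx (hgs h)), zero_smul]
    · intro q hq
      have hqc : q ∈ closure Ω := frontier_subset_closure hq
      have hd : DifferentiableWithinAt ℝ g (closure Ω) q :=
        (hg.differentiable (by simp) q).differentiableWithinAt
      have hz : fderivWithin ℝ g (closure Ω) q = 0 := by
        rw [(hg.differentiable (by simp) q).hasFDerivAt.hasFDerivWithinAt.fderivWithin (hu q hqc)]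
        have := (notMem_tsupport_iff_eventuallyEq.1 (hfr q hq))
        rw [this.fderiv_eq]; simp
      rw [PP_bd hu hqc hd (h0 q hq), QQ_bd hu hqc hd (h0 q hq), hz]
      simpa [Prod.zero_eq_mk] using tan_zero hq
  have h3 := Measure.eqOn_open_of_ae_eq (μ := (volume : Measure (ℝ × ℝ)))
    (f := fun p => (dzbarW Ω (dzbarW Ω f) p).im) (g := fun _ => 0) (U := Ω)
    ((ae_restrict_iff' hΩ.measurableSet).2 key) hΩ hcΩ continuousOn_const
  exact fun p hp => h3 hp

lemma glue_deriv (x : ℝ) : HasDerivAt expNegInvGlue ((x⁻¹) ^ 2 * expNegInvGlue x) x := by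
  simpa using expNegInvGlue.hasDerivAt_polynomial_eval_inv_mul 1 x

/-- squared Euclidean distance -/
def DD (c q : ℝ × ℝ) : ℝ := (q.1 - c.1) ^ 2 + (q.2 - c.2) ^ 2

lemma DD_smooth (c : ℝ × ℝ) : ContDiff ℝ ∞ (DD c) := by unfold DD; fun_prop

lemma DD_fderiv (c q v : ℝ × ℝ) :
    fderiv ℝ (DD c) q v = 2 * ((q.1 - c.1) * v.1 + (q.2 - c.2) * v.2) := by
  have h1 : HasFDerivAt (fun q : ℝ × ℝ => q.1 - c.1) (ContinuousLinearMap.fst ℝ ℝ ℝ) q :=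
    hasFDerivAt_fst.sub_const _
  have h2 : HasFDerivAt (fun q : ℝ × ℝ => q.2 - c.2) (ContinuousLinearMap.snd ℝ ℝ ℝ) q :=
    hasFDerivAt_snd.sub_const _
  have h3 : HasFDerivAt (DD c) _ q := (h1.pow 2).add (h2.pow 2)
  rw [h3.fderiv]
  simp
  ring

/-- bump -/
noncomputable def bmp (c : ℝ × ℝ) (e : ℝ) (q : ℝ × ℝ) : ℝ := expNegInvGlue (e - DD c q)

lemma bmp_smooth (c : ℝ × ℝ) (e : ℝ) : ContDiff ℝ ∞ (bmp c e) :=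
  expNegInvGlue.contDiff.comp (contDiff_const.sub (DD_smooth c))

lemma bmp_zero {c q : ℝ × ℝ} {e : ℝ} (h : e ≤ DD c q) : bmp c e q = 0 :=
  expNegInvGlue.zero_of_nonpos (by linarith)

lemma bmp_fderiv (c : ℝ × ℝ) (e : ℝ) (q v : ℝ × ℝ) :
    fderiv ℝ (bmp c e) q v = ((e - DD c q)⁻¹) ^ 2 * bmp c e q *
      (-2 * ((q.1 - c.1) * v.1 + (q.2 - c.2) * v.2)) := by
  have h1 : HasFDerivAt (DD c) (fderiv ℝ (DD c) q) q :=
    ((DD_smooth c).differentiable (by simp) q).hasFDerivAt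
  have h2 : HasFDerivAt (bmp c e) _ q :=
    (glue_deriv (e - DD c q)).comp_hasFDerivAt q (h1.const_sub e)
  rw [h2.fderiv]
  simp [DD_fderiv, bmp]

lemma tangent_alg {a b u w s t : ℝ} (e : s * a + t * b = 0) (n : s ^ 2 + t ^ 2 = 1) :
    (a ^ 2 + b ^ 2) * (u * (2 * s * t) + w * (s ^ 2 - t ^ 2))
      = -(2 * a * b * u + w * (a ^ 2 - b ^ 2)) := by
  have h1 : (a ^ 2 + b ^ 2) * (s * t) = - (a * b) := by
    linear_combination (a * t + b * s) * e - a * b * n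
  have h2 : (a ^ 2 + b ^ 2) * (s ^ 2 - t ^ 2) = b ^ 2 - a ^ 2 := by
    linear_combination 2 * (a * s - b * t) * e + (b ^ 2 - a ^ 2) * n
  linear_combination 2 * u * h1 + w * h2

/-- geometric choice of the bump -/
lemma choose_bump (hΩ : IsOpen Ω) (h : DefFn Ω U ρ) {z} (hzU : z ∈ U) (hz : z ∈ frontier Ω)
    {A : Set (ℝ × ℝ)} (hA : A ∈ 𝓝 z) :
    ∃ (c : ℝ × ℝ) (e : ℝ), (∀ q, DD c q ≤ e → q ∈ A) ∧ DD c z < e ∧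
      ∀ q ∈ Ω, DD c q < e → (q.1 - c.1) * fderiv ℝ ρ z (1, 0) +
        (q.2 - c.2) * fderiv ℝ ρ z (0, 1) < 0 := by
  have hN := grad_pos (h.2.2.1 z hzU)
  have h0 := h.zero hΩ hzU hz
  set a := fderiv ℝ ρ z (1, 0) with ha
  set b := fderiv ℝ ρ z (0, 1) with hb'
  set R := Real.sqrt (a ^ 2 + b ^ 2) with hR
  have hR0 : 0 < R := Real.sqrt_pos.2 hN
  have hR2 : R ^ 2 = a ^ 2 + b ^ 2 := Real.sq_sqrt hN.le
  have h1 : ∀ᶠ q in 𝓝 z, ‖ρ q - ρ z - fderiv ℝ ρ z (q - z)‖ ≤ R / 3 * ‖q - z‖ :=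
    (h.diff z).hasFDerivAt.isLittleO.def (by positivity)
  have h2 := (h1.and (h.1.mem_nhds hzU)).and hA
  obtain ⟨r, hr, hr'⟩ := Metric.eventually_nhds_iff.1 h2
  obtain ⟨s, hs0, hs⟩ : ∃ s : ℝ, 0 < s ∧ 3 * s * R < r :=
    ⟨r / (6 * R), by positivity, by field_simp; linarith⟩
  have haR : |a| ≤ R := abs_le_of_sq_le_sq (by nlinarith) hR0.le
  have hbR : |b| ≤ R := abs_le_of_sq_le_sq (by nlinarith) hR0.le
  have close : ∀ q : ℝ × ℝ, DD (z.1 + s * a, z.2 + s * b) q ≤ (2 * s * R) ^ 2 →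
      ‖q - z‖ ≤ 3 * s * R := by
    intro q hq
    unfold DD at hq
    have p1 : |q.1 - (z.1 + s * a)| ≤ 2 * s * R :=
      abs_le_of_sq_le_sq (by nlinarith [sq_nonneg (q.2 - (z.2 + s * b))]) (by positivity)
    have p2 : |q.2 - (z.2 + s * b)| ≤ 2 * s * R :=
      abs_le_of_sq_le_sq (by nlinarith [sq_nonneg (q.1 - (z.1 + s * a))]) (by positivity)
    rw [abs_le] at p1 p2 haR hbR
    have q1 := mul_le_mul_of_nonneg_left haR.1 hs0.le
    have q2 := mul_le_mul_of_nonneg_left haR.2 hs0.le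
    have q3 := mul_le_mul_of_nonneg_left hbR.1 hs0.le
    have q4 := mul_le_mul_of_nonneg_left hbR.2 hs0.le
    rw [Prod.norm_def, max_le_iff, Real.norm_eq_abs, Real.norm_eq_abs, abs_le, abs_le]
    simp only [Prod.fst_sub, Prod.snd_sub]
    refine ⟨⟨?_, ?_⟩, ?_, ?_⟩ <;> nlinarith
  refine ⟨(z.1 + s * a, z.2 + s * b), (2 * s * R) ^ 2, ?_, ?_, ?_⟩
  · intro q hq
    exact (hr' (by rw [dist_eq_norm]; exact (close q hq).trans_lt hs)).2
  · have : DD (z.1 + s * a, z.2 + s * b) z = s ^ 2 * R ^ 2 := by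
      rw [hR2]; unfold DD; ring
    rw [this]
    have : 0 < s ^ 2 * R ^ 2 := by positivity
    nlinarith
  · intro q hq hqe
    have k1 := close q hqe.le
    obtain ⟨⟨k2, k3⟩, -⟩ := hr' (show dist q z < r by rw [dist_eq_norm]; exact k1.trans_lt hs)
    have k4 := (h.mem_iff k3).1 hq
    have k5 : fderiv ℝ ρ z (q - z) = (q.1 - z.1) * a + (q.2 - z.2) * b := clm_pair _ _ _
    rw [h0, k5, Real.norm_eq_abs, abs_le] at k2
    have k6 : R / 3 * ‖q - z‖ ≤ R / 3 * (3 * s * R) := by gcongr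
    have k7 : R / 3 * (3 * s * R) = s * (a ^ 2 + b ^ 2) := by rw [← hR2]; ring
    simp only
    nlinarith [k2.1]

lemma cond_two (hΩ : IsOpen Ω) (hb : Bornology.IsBounded Ω) (hsb : HasSmoothBoundary Ω)
    {f : ℝ × ℝ → ℂ} (hf : ContDiffOn ℝ ∞ f (closure Ω))
    (H : ∀ ψ : ℝ × ℝ → ℝ, ContDiffOn ℝ ∞ ψ (closure Ω) → (∀ p ∈ frontier Ω, ψ p = 0) →
      (∫ p in Ω, f p * dzbarW Ω (dzbarW Ω (fun q => ((ψ q : ℝ) : ℂ))) p).im = 0) :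
    ∀ z ∈ frontier Ω, ∀ τ : ℂ, IsUnitTangent Ω z τ → (f z * τ ^ 2).im = 0 := by
  intro z hz τ hτ
  by_contra hne
  have hu := uniqueDiffOn_closure hΩ hsb
  have H1 := cond_one hΩ hb hsb hf H
  have hzc : z ∈ closure Ω := frontier_subset_closure hz
  obtain ⟨U, ρ, h, hzU⟩ := exists_defFn hΩ hb hsb hzc
  set G : ℝ × ℝ → ℝ := fun q => 2 * fderiv ℝ ρ q (1, 0) * fderiv ℝ ρ q (0, 1) * (f q).re
    + (f q).im * (fderiv ℝ ρ q (1, 0) ^ 2 - fderiv ℝ ρ q (0, 1) ^ 2) with hG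
  have hGs : ContDiffOn ℝ ∞ G (closure Ω) := by
    have s1 := (fd_smooth h.2.1 (1, 0)).contDiffOn (s := closure Ω)
    have s2 := (fd_smooth h.2.1 (0, 1)).contDiffOn (s := closure Ω)
    exact (((contDiffOn_const.mul s1).mul s2).mul (re_smooth hf)).add
      ((im_smooth hf).mul ((s1.pow 2).sub (s2.pow 2)))
  have hGz : G z ≠ 0 := by
    intro h0
    apply hne
    have e1 : fderiv ℝ ρ z (τ.re, τ.im) = 0 := Tan.fderiv_zero hΩ h hzU hτ.2
    rw [clm_pair] at e1
    have n1 : τ.re ^ 2 + τ.im ^ 2 = 1 := by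
      have := hτ.1
      rwa [Complex.norm_eq_sqrt_sq_add_sq, Real.sqrt_eq_one] at this
    have e2 := tangent_alg (u := (f z).re) (w := (f z).im) e1 n1
    have e3 : (f z * τ ^ 2).im
      = (f z).re * (2 * τ.re * τ.im) + (f z).im * (τ.re ^ 2 - τ.im ^ 2) := by
      simp only [sq, Complex.mul_im, Complex.mul_re]; ring
    rw [e3]
    have hN := grad_pos (h.2.2.1 z hzU)
    refine (mul_eq_zero.1 (e2.trans ?_)).resolve_left hN.ne'
    simp only [hG] at h0
    linarith
  have hGn : ∀ᶠ q in 𝓝[closure Ω] z, G q ≠ 0 := (hGs.continuousOn z hzc).eventually_ne hGz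
  obtain ⟨c, e, hA, hze, hneg⟩ := choose_bump hΩ h hzU hz
    (inter_mem (h.1.mem_nhds hzU) (eventually_nhdsWithin_iff.1 hGn))
  have hU : ∀ q, DD c q ≤ e → q ∈ U := fun q hq => (hA q hq).1
  have hGq : ∀ q ∈ closure Ω, DD c q ≤ e → G q ≠ 0 := fun q hq hq' => (hA q hq').2 hq
  set φ := bmp c e with hφ
  set n₁ := fderiv ℝ ρ z (1, 0) with hn₁
  set n₂ := fderiv ℝ ρ z (0, 1) with hn₂
  have hφs : ContDiff ℝ ∞ φ := bmp_smooth c e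
  set L : ℝ × ℝ → ℝ := fun q => 4 * φ q * fderiv ℝ ρ q (n₁, n₂) / G q with hL
  set ψ : ℝ × ℝ → ℝ := fun q => L q * ρ q with hψdef
  have hDo : ∀ q, e < DD c q → ∀ᶠ p in 𝓝 q, e < DD c p := fun q hq =>
    (DD_smooth c).continuous.continuousAt.eventually (lt_mem_nhds hq)
  have hψz : ∀ q, e < DD c q → ψ q = 0 := by
    intro q hq
    simp [hψdef, hL, hφ, bmp_zero hq.le]
  have hLs : ∀ q ∈ closure Ω, DD c q ≤ e → ContDiffWithinAt ℝ ∞ L (closure Ω) q := by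
    intro q hq hqe
    exact (((contDiff_const.mul hφs).mul (fd_smooth h.2.1 _)).contDiffWithinAt).div
      (hGs q hq) (hGq q hq hqe)
  have hψs : ContDiffOn ℝ ∞ ψ (closure Ω) := by
    intro q hq
    rcases le_or_gt (DD c q) e with hqe | hqe
    · exact (hLs q hq hqe).mul h.2.1.contDiffWithinAt
    · refine ContDiffAt.contDiffWithinAt (ContDiffAt.congr_of_eventuallyEq
        (f := fun _ => (0 : ℝ)) contDiffAt_const ?_)
      filter_upwards [hDo q hqe] with p hp using hψz p hp
  have hψ0 : ∀ q ∈ frontier Ω, ψ q = 0 := by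
    intro q hq
    rcases le_or_gt (DD c q) e with hqe | hqe
    · simp [hψdef, h.zero hΩ (hU q hqe) hq]
    · exact hψz q hqe
  have hI := H ψ hψs hψ0
  rw [green_int hΩ hb hu hf hψs] at hI
  have hI0 : ∫ p in Ω, ψ p * (dzbarW Ω (dzbarW Ω f) p).im = 0 := by
    rw [setIntegral_congr_fun (g := fun _ => (0 : ℝ)) hΩ.measurableSet]
    · simp
    · intro p hp
      simp [H1 p hp]
  rw [hI0, zero_add] at hI
  have sP := PP_smooth hu hf hψs
  have sQ := QQ_smooth hu hf hψs
  have hT := div_zero hΩ hb hsb (P := fun q => n₁ * φ q - PP Ω f ψ q)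
    (Q := fun q => n₂ * φ q - QQ Ω f ψ q) ((contDiff_const.mul hφs).contDiffOn.sub sP)
    ((contDiff_const.mul hφs).contDiffOn.sub sQ) (by
      intro q hq
      have hqc : q ∈ closure Ω := frontier_subset_closure hq
      have hd : DifferentiableWithinAt ℝ ψ (closure Ω) q := hψs.differentiableOn (by simp) q hqc
      rw [PP_bd hu hqc hd (hψ0 q hq), QQ_bd hu hqc hd (hψ0 q hq)]
      rcases le_or_gt (DD c q) e with hqe | hqe
      · have hρ0 := h.zero hΩ (hU q hqe) hq
        have hfd : ∀ v, fderivWithin ℝ ψ (closure Ω) q v = L q * fderiv ℝ ρ q v := by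
          intro v
          have m := fderivWithin_fun_mul (hu q hqc) ((hLs q hqc hqe).differentiableWithinAt
            (by simp)) (h.diff q).differentiableWithinAt
          rw [hψdef, m, hρ0, (h.diff q).fderivWithin (hu q hqc)]
          simp
        have hG0 := hGq q hqc hqe
        have hLG : L q * G q = 4 * φ q * fderiv ℝ ρ q (n₁, n₂) := by
          simp only [hL]; field_simp
        rw [clm_pair] at hLG
        apply tan_of_zero hΩ h (hU q hqe) hq
        rw [clm_pair, hfd, hfd]
        simp only [hG] at hLG
        linear_combination (-1 / 4) * hLG
      · have hz0 : fderivWithin ℝ ψ (closure Ω) q = 0 := by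
          have : ψ =ᶠ[𝓝[closure Ω] q] fun _ => 0 := by
            filter_upwards [nhdsWithin_le_nhds (hDo q hqe)] with p hp using hψz p hp
          rw [this.fderivWithin_eq (hψ0 q hq)]; simp
        have : φ q = 0 := bmp_zero hqe.le
        rw [hz0, this]
        simpa [Prod.zero_eq_mk] using tan_zero hq)
  have hsplit : ∀ p ∈ Ω, dv Ω (fun q => n₁ * φ q - PP Ω f ψ q) (fun q => n₂ * φ q - QQ Ω f ψ q) p
      = fderiv ℝ φ p (n₁, n₂) - dv Ω (PP Ω f ψ) (QQ Ω f ψ) p := by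
    intro p hp
    have hpc := subset_closure hp
    have dφ := hφs.differentiable (by simp) p
    have d1 : HasFDerivWithinAt (fun q => n₁ * φ q - PP Ω f ψ q) _ (closure Ω) p :=
      (dφ.hasFDerivAt.hasFDerivWithinAt.const_mul n₁).sub
        (sP.differentiableOn (by simp) p hpc).hasFDerivWithinAt
    have d2 : HasFDerivWithinAt (fun q => n₂ * φ q - QQ Ω f ψ q) _ (closure Ω) p :=
      (dφ.hasFDerivAt.hasFDerivWithinAt.const_mul n₂).sub
        (sQ.differentiableOn (by simp) p hpc).hasFDerivWithinAt
    rw [clm_pair]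
    simp only [dv, d1.fderivWithin (hu p hpc), d2.fderivWithin (hu p hpc)]
    simp
    ring
  have hcφ : Continuous (fun p => fderiv ℝ φ p (n₁, n₂)) := (fd_smooth hφs _).continuous
  have i1 : IntegrableOn (fun p => fderiv ℝ φ p (n₁, n₂)) Ω := int_of_cont hb hcφ.continuousOn
  have i2 := int_of_cont hb (dv_cont hu sP sQ)
  rw [setIntegral_congr_fun hΩ.measurableSet hsplit, integral_sub i1 i2, hI, sub_zero] at hT
  have hpos : ∀ p ∈ Ω, 0 ≤ fderiv ℝ φ p (n₁, n₂) ∧ (DD c p < e → 0 < fderiv ℝ φ p (n₁, n₂)) := by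
    intro p hp
    rw [hφ, bmp_fderiv]
    rcases lt_or_ge (DD c p) e with hpe | hpe
    · have k1 := hneg p hp hpe
      have k2 : 0 < bmp c e p := expNegInvGlue.pos_of_pos (by linarith)
      have k3 : 0 < (e - DD c p)⁻¹ := inv_pos.2 (by linarith)
      have k4 : 0 < ((e - DD c p)⁻¹) ^ 2 * bmp c e p *
        (-2 * ((p.1 - c.1) * n₁ + (p.2 - c.2) * n₂)) :=
        mul_pos (mul_pos (pow_pos k3 2) k2) (by linarith)
      exact ⟨k4.le, fun _ => k4⟩
    · rw [bmp_zero hpe]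
      simp [hpe.not_gt]
  have hae := (setIntegral_eq_zero_iff_of_nonneg_ae
    ((ae_restrict_iff' hΩ.measurableSet).2 (Eventually.of_forall fun p hp => (hpos p hp).1)) i1).1 hT
  have hz3 := Measure.eqOn_open_of_ae_eq (μ := (volume : Measure (ℝ × ℝ))) (g := fun _ => 0)
    (U := Ω) hae hΩ hcφ.continuousOn continuousOn_const
  obtain ⟨p, hp1, hp2⟩ := mem_closure_iff.1 hzc {q | DD c q < e}
    (isOpen_lt (DD_smooth c).continuous continuous_const) hze
  have := (hpos p hp2).2 hp1
  exact absurd (hz3 hp2) this.ne'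

end HopfAux

end Helpers

/-- `Φ ∈ O(Ω; Ω₁)` is quasi-rigid, i.e.
`Im ∫_Ω f_Φ ∂²_z̄ψ = 0` for all smooth `ψ` vanishing on `∂Ω`, if and only if
`Area(Ω) = Area(Ω₁)`, (i) `Im(∂²_z̄ f_Φ) = 0` on `Ω`, and
(ii) `Im(f_Φ τ²) = 0` on `∂Ω` for unit tangents `τ` (the Hopf differential
`f_Φ dz²` is real along `∂Ω`). -/
theorem stmt_4 (Ω Ω₁ : Set (ℝ × ℝ)) (hΩ : IsOpen Ω) (hΩ₁ : IsOpen Ω₁)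
    (hbd : Bornology.IsBounded Ω) (hbd₁ : Bornology.IsBounded Ω₁)
    (hsb : HasSmoothBoundary Ω) (hsb₁ : HasSmoothBoundary Ω₁)
    (Φ : ℝ × ℝ → ℝ × ℝ) (hΦ : IsAPD Ω Ω₁ Φ) :
    (∀ ψ : ℝ × ℝ → ℝ, ContDiffOn ℝ (⊤ : ℕ∞) ψ (closure Ω) → (∀ p ∈ frontier Ω, ψ p = 0) →
        (∫ p in Ω, hopfW Ω Φ p * dzbarW Ω (dzbarW Ω (fun q => ((ψ q : ℝ) : ℂ))) p).im = 0)
      ↔ (volume Ω = volume Ω₁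
          ∧ (∀ p ∈ Ω, (dzbarW Ω (dzbarW Ω (hopfW Ω Φ)) p).im = 0)
          ∧ ∀ z ∈ frontier Ω, ∀ τ : ℂ, IsUnitTangent Ω z τ →
              (hopfW Ω Φ z * τ ^ 2).im = 0) := by
  have hu := HopfAux.uniqueDiffOn_closure hΩ hsb
  have hf := HopfAux.hopf_smooth hu hΦ.1
  constructor
  · intro H
    exact ⟨HopfAux.area hΩ hΦ, HopfAux.cond_one hΩ hbd hsb hf H,
      HopfAux.cond_two hΩ hbd hsb hf H⟩
  · rintro ⟨-, h1, h2⟩ ψ hψ hψ0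
    exact HopfAux.backward hΩ hbd hsb hf hψ hψ0 h1 h2
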